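/- Under Condition (6), for every integer j ≥ 1, lim_{t→∞} ρ_j(t) / ((log t)^{j(β+1)} (ℓ(log t))^j) = (Γ(β+1))^j / Γ(1 + j(β+1)). -/

import Mathlib

open Filter Topology

/-- Product weight of a box `r` in generation `j`: `p_r = p_{r 0} ⋯ p_{r (j-1)}`. -/
noncomputable def prodP (p : ℕ → ℝ) (j : ℕ) (r : Fin j → ℕ) : ℝ := ∏ i, p (r i)

/-- Counting function of generation `j`: `ρ_j(x) = #{r ∈ ℕ^j : p_r ≥ 1/x}` (as a real number). -/
noncomputable def rhoJ (p : ℕ → ℝ) (j : ℕ) (x : ℝ) : ℝ :=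
  (Nat.card {r : Fin j → ℕ // 1 / x ≤ prodP p j r} : ℝ)


/-- Uniform convergence theorem (additive form), proved through Baire category. -/
theorem uct (k : ℝ → ℝ) (hk : ∀ y, Tendsto (fun u => k (u + y) - k u) atTop (𝓝 0))
    (hloc : ∀ ε > 0, ∃ N, ∀ u ≥ N, ∃ δ > 0, ∀ h, |h| ≤ δ → |k (u + h) - k u| ≤ ε) :
    ∀ ε > 0, ∀ M : ℝ, ∃ N, ∀ u ≥ N, ∀ y, 0 ≤ y → y ≤ M → |k (u + y) - k u| ≤ ε := by
  intro ε hε M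
  set e := ε / 5 with he
  have he0 : 0 < e := by positivity
  let A : ℕ → Set ℝ := fun n => {y | ∀ u ≥ (n : ℝ), |k (u + y) - k u| ≤ e}
  have hcov : (⋃ n, closure (A n)) = Set.univ := by
    rw [Set.eq_univ_iff_forall]
    intro y
    have h1 : ∀ᶠ u in atTop, |k (u + y) - k u| ≤ e := by
      have := (hk y).eventually (Metric.closedBall_mem_nhds 0 he0)
      filter_upwards [this] with u hu
      simpa [Real.dist_eq] using hu
    obtain ⟨N, hN⟩ := eventually_atTop.1 h1
    obtain ⟨n, hn⟩ := exists_nat_ge N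
    exact Set.mem_iUnion.2 ⟨n, subset_closure (fun u hu => hN u (hn.trans hu))⟩
  obtain ⟨n, x, hx⟩ := nonempty_interior_of_iUnion_of_closed (fun n => isClosed_closure) hcov
  obtain ⟨r, hr, hball⟩ := Metric.isOpen_iff.1 isOpen_interior x hx
  obtain ⟨N₁, hN₁⟩ := hloc e he0
  -- closure bound
  have hcl : ∀ y ∈ closure (A n), ∀ u ≥ (n : ℝ), N₁ ≤ u + y → |k (u + y) - k u| ≤ 2 * e := by
    intro y hy u hu huy
    obtain ⟨δ, hδ, hd⟩ := hN₁ (u + y) huy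
    obtain ⟨y', hy', hyy⟩ := Metric.mem_closure_iff.1 hy δ hδ
    have h1 := hd (y' - y) (by rw [Real.dist_eq, abs_sub_comm] at hyy; exact hyy.le)
    have h2 := hy' u hu
    have e1 : u + y + (y' - y) = u + y' := by ring
    rw [e1] at h1
    rw [abs_le] at *
    constructor <;> linarith [h1.1, h1.2, h2.1, h2.2]
  -- short intervals
  set d := r / 2 with hd
  have hd0 : 0 < d := by positivity
  have hshort : ∃ N₂, ∀ u ≥ N₂, ∀ y, 0 ≤ y → y ≤ d → |k (u + y) - k u| ≤ 4 * e := by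
    refine ⟨max (n + x) (max N₁ 0), fun u hu y hy0 hyd => ?_⟩
    have hu1 : (n : ℝ) + x ≤ u := (le_max_left _ _).trans hu
    have hu2 : N₁ ≤ u := ((le_max_left _ _).trans (le_max_right _ _)).trans hu
    have hxA : x ∈ closure (A n) := interior_subset hx
    have hyA : x + y ∈ closure (A n) := by
      apply interior_subset
      apply hball
      rw [Metric.mem_ball, Real.dist_eq, add_sub_cancel_left, abs_of_nonneg hy0]
      linarith
    have h1 := hcl x hxA (u - x) (by linarith) (by linarith)
    have h2 := hcl (x + y) hyA (u - x) (by linarith) (by linarith)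
    have e1 : u - x + x = u := by ring
    have e2 : u - x + (x + y) = u + y := by ring
    rw [e1] at h1
    rw [e2] at h2
    rw [abs_le] at *
    constructor <;> linarith [h1.1, h1.2, h2.1, h2.2]
  obtain ⟨N₂, hN₂⟩ := hshort
  obtain ⟨m, hm⟩ := exists_nat_ge (M / d)
  have hgrid : ∀ᶠ u in atTop, ∀ i ∈ Finset.range (m + 1), |k (u + i * d) - k u| ≤ e := by
    rw [Filter.eventually_all_finset]
    intro i _
    have := (hk (i * d)).eventually (Metric.closedBall_mem_nhds 0 he0)
    filter_upwards [this] with u hu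
    simpa [Real.dist_eq] using hu
  obtain ⟨N₃, hN₃⟩ := eventually_atTop.1 hgrid
  refine ⟨max N₂ N₃, fun u hu y hy0 hyM => ?_⟩
  have hu2 : N₂ ≤ u := (le_max_left _ _).trans hu
  have hu3 : N₃ ≤ u := (le_max_right _ _).trans hu
  set i := ⌊y / d⌋₊ with hi
  have hyd : 0 ≤ y / d := by positivity
  have hi1 : (i : ℝ) ≤ y / d := Nat.floor_le hyd
  have hi2 : y / d < i + 1 := Nat.lt_floor_add_one _
  rw [le_div_iff₀ hd0] at hi1
  rw [div_lt_iff₀ hd0] at hi2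
  have him : i ≤ m := by
    have : y / d ≤ m := le_trans (by gcongr) hm
    exact Nat.floor_le_of_le this
  have h1 := hN₃ u hu3 i (Finset.mem_range.2 (by omega))
  have hid : 0 ≤ (i : ℝ) * d := by positivity
  have h2 := hN₂ (u + i * d) (by linarith) (y - i * d) (by linarith) (by linarith)
  have e1 : u + i * d + (y - i * d) = u + y := by ring
  rw [e1] at h2
  have h5 : ε = 5 * e := by rw [he]; ring
  rw [h5]
  rw [abs_le] at *
  constructor <;> linarith [h1.1, h1.2, h2.1, h2.2]

theorem log_near (R G : ℝ → ℝ) (hR : Monotone R) (hG : ∀ s > 0, 0 < G s)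
    (h6 : ∀ h, Tendsto (fun s => (R (s + h) - R s) / G s) atTop (𝓝 h)) :
    ∀ ε > 0, ∃ N, ∃ η > 0, ∀ s ≥ N, ∀ h, 0 ≤ h → h ≤ η →
      |Real.log (G (s + h)) - Real.log (G s)| ≤ ε := by
  intro ε hε
  obtain ⟨η, hη0, hη1, ha, hb⟩ : ∃ η : ℝ, 0 < η ∧ η < 1 ∧ Real.log (1 + η) < ε / 2 ∧
      -(ε / 2) < Real.log (1 - η) := by
    have c1 : Tendsto (fun η : ℝ => Real.log (1 + η)) (𝓝[>] 0) (𝓝 0) := by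
      have : ContinuousAt (fun η : ℝ => Real.log (1 + η)) 0 :=
        ContinuousAt.log (by fun_prop) (by norm_num)
      simpa [ContinuousAt] using this.mono_left (nhdsWithin_le_nhds (s := Set.Ioi 0))
    have c2 : Tendsto (fun η : ℝ => Real.log (1 - η)) (𝓝[>] 0) (𝓝 0) := by
      have : ContinuousAt (fun η : ℝ => Real.log (1 - η)) 0 :=
        ContinuousAt.log (by fun_prop) (by norm_num)
      simpa [ContinuousAt] using this.mono_left (nhdsWithin_le_nhds (s := Set.Ioi 0))
    have e1 := c1.eventually (gt_mem_nhds (half_pos hε))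
    have e2 := c2.eventually (lt_mem_nhds (neg_lt_zero.2 (half_pos hε)))
    have e3 : ∀ᶠ η : ℝ in 𝓝[>] 0, η ∈ Set.Ioo (0 : ℝ) 1 := Ioo_mem_nhdsGT one_pos
    obtain ⟨η, h1, h2, h3⟩ := (e1.and (e2.and e3)).exists
    exact ⟨η, h3.1, h3.2, h1, h2⟩
  have t0 : Tendsto (fun s => Real.log ((R (s + 1) - R s) / G s)) atTop (𝓝 0) := by
    have := (h6 1).log one_ne_zero
    simpa using this
  have t1 : Tendsto (fun s => Real.log ((R (s + (1 + η)) - R s) / G s)) atTop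
      (𝓝 (Real.log (1 + η))) := (h6 (1 + η)).log (by linarith)
  have t2' : Tendsto (fun s => (R (s + 1) - R (s + η)) / G s) atTop (𝓝 (1 - η)) := by
    refine ((h6 1).sub (h6 η)).congr (fun s => ?_)
    ring
  have t2 := t2'.log (by linarith : (1 - η) ≠ 0)
  have E0 := t0.eventually (Metric.closedBall_mem_nhds 0 (half_pos hε))
  have E1 := t1.eventually (gt_mem_nhds ha)
  have E2 := t2.eventually (lt_mem_nhds hb)
  have E3 := (h6 1).eventually (lt_mem_nhds one_pos)
  have E4 := t2'.eventually (lt_mem_nhds (by linarith : (0 : ℝ) < 1 - η))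
  obtain ⟨N, hN⟩ := eventually_atTop.1 (E0.and (E1.and (E2.and (E3.and (E4.and (eventually_gt_atTop 0))))))
  refine ⟨N, η, hη0, fun s hs h h0 hh => ?_⟩
  obtain ⟨-, F1, F2, -, F4, F5⟩ := hN s hs
  obtain ⟨F0, -, -, F3, -, F6⟩ := hN (s + h) (by linarith)
  have g1 := hG s F5
  have g2 := hG (s + h) F6
  have hg : 0 < R (s + h + 1) - R (s + h) := by
    by_contra hc
    exact absurd F3 (not_lt.2 (div_nonpos_of_nonpos_of_nonneg (not_lt.1 hc) g2.le))
  have hg' : 0 < R (s + 1) - R (s + η) := by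
    by_contra hc
    exact absurd F4 (not_lt.2 (div_nonpos_of_nonpos_of_nonneg (not_lt.1 hc) g1.le))
  have m1 : R (s + h + 1) ≤ R (s + (1 + η)) := hR (by linarith)
  have m2 : R s ≤ R (s + h) := hR (by linarith)
  have m3 : R (s + 1) ≤ R (s + h + 1) := hR (by linarith)
  have m4 : R (s + h) ≤ R (s + η) := hR (by linarith)
  have hg'' : 0 < R (s + (1 + η)) - R s := by linarith
  rw [Real.log_div hg''.ne' g1.ne'] at F1
  rw [Real.log_div hg'.ne' g1.ne'] at F2
  rw [Real.dist_eq, sub_zero, Real.log_div hg.ne' g2.ne'] at F0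
  have l1 := Real.log_le_log hg (by linarith : R (s + h + 1) - R (s + h) ≤ R (s + (1 + η)) - R s)
  have l2 := Real.log_le_log hg' (by linarith : R (s + 1) - R (s + η) ≤ R (s + h + 1) - R (s + h))
  rw [abs_le] at *
  constructor <;> linarith [F0.1, F0.2]

theorem ell_unif (R ℓ : ℝ → ℝ) (β : ℝ) (hR : Monotone R) (hℓ : ∀ s > 0, 0 < ℓ s)
    (hsv : ∀ c > 0, Tendsto (fun x => ℓ (c * x) / ℓ x) atTop (𝓝 1))
    (h6 : ∀ h, Tendsto (fun s => (R (s + h) - R s) / (s ^ β * ℓ s)) atTop (𝓝 h)) :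
    ∀ ε > 0, ∀ q > 1, ∃ N > 0, ∀ s ≥ N, ∀ t, s ≤ t → t ≤ q * s →
      |Real.log (ℓ t) - Real.log (ℓ s)| ≤ ε := by
  have hG : ∀ s > 0, 0 < s ^ β * ℓ s := fun s hs => mul_pos (Real.rpow_pos_of_pos hs _) (hℓ s hs)
  have near := log_near R (fun s => s ^ β * ℓ s) hR hG h6
  have key := uct (fun u => Real.log (ℓ (Real.exp u))) ?_ ?_
  · intro ε hε q hq
    obtain ⟨N, hN⟩ := key ε hε (Real.log q)
    refine ⟨Real.exp N, Real.exp_pos _, fun s hs t hst htq => ?_⟩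
    have hs0 : 0 < s := (Real.exp_pos _).trans_le hs
    have ht0 : 0 < t := hs0.trans_le hst
    have h1 : N ≤ Real.log s := (Real.le_log_iff_exp_le hs0).2 hs
    have h2 : Real.log s ≤ Real.log t := Real.log_le_log hs0 hst
    have h3 : Real.log t ≤ Real.log q + Real.log s := by
      rw [← Real.log_mul (by linarith) hs0.ne']
      exact Real.log_le_log ht0 htq
    have := hN (Real.log s) h1 (Real.log t - Real.log s) (by linarith) (by linarith)
    simpa [Real.exp_log hs0, Real.exp_log ht0] using this
  · intro y
    have h1 := ((hsv (Real.exp y) (Real.exp_pos y)).comp Real.tendsto_exp_atTop).log one_ne_zero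
    rw [Real.log_one] at h1
    refine h1.congr (fun u => ?_)
    simp only [Function.comp]
    rw [Real.log_div (hℓ _ (by positivity)).ne' (hℓ _ (by positivity)).ne', Real.exp_add, mul_comm]
  · intro ε hε
    obtain ⟨N, η, hη, hN⟩ := near (ε / 2) (half_pos hε)
    refine ⟨Real.log (max N 1 + 1), fun u hu => ?_⟩
    have hu1 : max N 1 + 1 ≤ Real.exp u := (Real.log_le_iff_le_exp (by positivity)).1 hu
    have hM : N ≤ max N 1 := le_max_left _ _
    have c1 : ∀ᶠ h in 𝓝 (0 : ℝ), |Real.exp (u + h) - Real.exp u| ≤ min η 1 := by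
      have : ContinuousAt (fun h : ℝ => Real.exp (u + h)) 0 := by fun_prop
      have := this.eventually (Metric.closedBall_mem_nhds _ (lt_min hη one_pos))
      filter_upwards [this] with h hh
      simpa only [Metric.mem_closedBall, Real.dist_eq, add_zero] using hh
    have c2 : ∀ᶠ h in 𝓝 (0 : ℝ), |β * h| ≤ ε / 2 := by
      have : ContinuousAt (fun h : ℝ => β * h) 0 := by fun_prop
      have := this.eventually (Metric.closedBall_mem_nhds _ (half_pos hε))
      filter_upwards [this] with h hh
      simpa only [Metric.mem_closedBall, Real.dist_eq, mul_zero, sub_zero] using hh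
    obtain ⟨δ, hδ, hd⟩ := Metric.eventually_nhds_iff.1 (c1.and c2)
    refine ⟨δ / 2, half_pos hδ, fun h hh => ?_⟩
    obtain ⟨d1, d2⟩ := hd (y := h) (by rw [Real.dist_eq, sub_zero]; linarith)
    have lg : ∀ v : ℝ, Real.log (Real.exp v ^ β * ℓ (Real.exp v)) = β * v + Real.log (ℓ (Real.exp v)) := by
      intro v
      rw [Real.log_mul (by positivity) (hℓ _ (Real.exp_pos _)).ne', Real.log_rpow (Real.exp_pos _), Real.log_exp]
    have d3 := d1.trans (min_le_left _ _)
    have d4 := d1.trans (min_le_right _ _)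
    have main : |Real.log (Real.exp (u + h) ^ β * ℓ (Real.exp (u + h))) -
        Real.log (Real.exp u ^ β * ℓ (Real.exp u))| ≤ ε / 2 := by
      rw [abs_le] at d3 d4
      rcases le_total (Real.exp u) (Real.exp (u + h)) with hc | hc
      · have := hN (Real.exp u) (by linarith) (Real.exp (u + h) - Real.exp u) (by linarith) (by linarith)
        simpa using this
      · have := hN (Real.exp (u + h)) (by linarith) (Real.exp u - Real.exp (u + h)) (by linarith) (by linarith)
        rw [abs_sub_comm]
        simpa using this
    rw [lg, lg] at main
    rw [abs_le] at *
    constructor <;> linarith [main.1, main.2]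

theorem steps_le (R : ℝ → ℝ) (t B : ℝ) (n : ℕ)
    (h : ∀ i < n, R (t + i + 1) - R (t + i) ≤ B) : R (t + n) - R t ≤ n * B := by
  induction n with
  | zero => simp
  | succ n ih =>
    have h1 := ih (fun i hi => h i (by omega))
    have h2 := h n (by omega)
    push_cast
    rw [← add_assoc]
    linarith

theorem incr_bounds (R ℓ : ℝ → ℝ) (β : ℝ) (hβ : 0 ≤ β) (hR : Monotone R) (hℓ : ∀ s > 0, 0 < ℓ s)
    (hsv : ∀ c > 0, Tendsto (fun x => ℓ (c * x) / ℓ x) atTop (𝓝 1))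
    (h6 : ∀ h, Tendsto (fun s => (R (s + h) - R s) / (s ^ β * ℓ s)) atTop (𝓝 h))
    (q : ℝ) (hq : 1 < q) (ε : ℝ) (hε : 0 < ε) :
    ∀ᶠ t in atTop,
      (R (q * t) - R t) / (t * (t ^ β * ℓ t)) ≤ (q - 1 + 1 / t) * (Real.exp (2 * ε) * q ^ β) ∧
      (q - 1 - 1 / t) * Real.exp (-(2 * ε)) ≤ (R (q * t) - R t) / (t * (t ^ β * ℓ t)) := by
  obtain ⟨N, hN0, hN⟩ := ell_unif R ℓ β hR hℓ hsv h6 ε hε q hq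
  have E1 := (h6 1).eventually (gt_mem_nhds (by simpa using hε : (1 : ℝ) < Real.exp ε))
  have E2 := (h6 1).eventually (lt_mem_nhds (by simpa using hε : Real.exp (-ε) < (1 : ℝ)))
  obtain ⟨N₁, hN₁⟩ := eventually_atTop.1 (E1.and E2)
  filter_upwards [eventually_ge_atTop N, eventually_ge_atTop N₁] with t ht ht1
  have ht0 : 0 < t := hN0.trans_le ht
  have hG : ∀ s > 0, 0 < s ^ β * ℓ s := fun s hs => mul_pos (Real.rpow_pos_of_pos hs _) (hℓ s hs)
  have key : ∀ s, t ≤ s → s ≤ q * t →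
      R (s + 1) - R s ≤ Real.exp (2 * ε) * q ^ β * (t ^ β * ℓ t) ∧
      Real.exp (-(2 * ε)) * (t ^ β * ℓ t) ≤ R (s + 1) - R s := by
    intro s h1 h2
    have hs0 := ht0.trans_le h1
    obtain ⟨a1, a2⟩ := hN₁ s (ht1.trans h1)
    rw [div_lt_iff₀ (hG s hs0)] at a1
    rw [lt_div_iff₀ (hG s hs0)] at a2
    have b := abs_le.1 (hN t ht s h1 h2)
    have lt0 := hℓ t ht0
    have ls0 := hℓ s hs0
    have b1 : ℓ s ≤ Real.exp ε * ℓ t := by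
      rw [← Real.exp_log ls0, ← Real.exp_log lt0, ← Real.exp_add]
      exact Real.exp_le_exp.2 (by linarith [b.2])
    have b2 : Real.exp (-ε) * ℓ t ≤ ℓ s := by
      rw [← Real.exp_log ls0, ← Real.exp_log lt0, ← Real.exp_add]
      exact Real.exp_le_exp.2 (by linarith [b.1])
    have c1 : s ^ β ≤ q ^ β * t ^ β := by
      rw [← Real.mul_rpow (by linarith) ht0.le]
      exact Real.rpow_le_rpow hs0.le h2 hβ
    have c2 : t ^ β ≤ s ^ β := Real.rpow_le_rpow ht0.le h1 hβ
    have tb := Real.rpow_pos_of_pos ht0 β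
    have sb := Real.rpow_pos_of_pos hs0 β
    have qb := Real.rpow_pos_of_pos (by linarith : 0 < q) β
    have e1 : Real.exp (2 * ε) = Real.exp ε * Real.exp ε := by rw [← Real.exp_add]; ring_nf
    have e2 : Real.exp (-(2 * ε)) = Real.exp (-ε) * Real.exp (-ε) := by rw [← Real.exp_add]; ring_nf
    constructor
    · calc R (s + 1) - R s ≤ Real.exp ε * (s ^ β * ℓ s) := a1.le
        _ ≤ Real.exp ε * ((q ^ β * t ^ β) * (Real.exp ε * ℓ t)) := by gcongr
        _ = _ := by rw [e1]; ring
    · calc Real.exp (-(2 * ε)) * (t ^ β * ℓ t) = Real.exp (-ε) * (t ^ β * (Real.exp (-ε) * ℓ t)) := by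
            rw [e2]; ring
        _ ≤ Real.exp (-ε) * (s ^ β * ℓ s) := by gcongr
        _ ≤ _ := a2.le
  have hd : 0 ≤ (q - 1) * t := mul_nonneg (by linarith) ht0.le
  set n := ⌊(q - 1) * t⌋₊ with hn
  have n1 : (n : ℝ) ≤ (q - 1) * t := Nat.floor_le hd
  have n2 : (q - 1) * t < n + 1 := Nat.lt_floor_add_one _
  have hGt := hG t ht0
  have hD : 0 < t * (t ^ β * ℓ t) := mul_pos ht0 hGt
  constructor
  · have s1 := steps_le R t (Real.exp (2 * ε) * q ^ β * (t ^ β * ℓ t)) (n + 1) (by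
      intro i hi
      have : (i : ℝ) ≤ n := by exact_mod_cast Nat.lt_succ_iff.1 hi
      have i0 : (0 : ℝ) ≤ i := i.cast_nonneg
      exact (key (t + i) (by linarith) (by linarith)).1)
    have s2 : R (q * t) ≤ R (t + (n + 1 : ℕ)) := hR (by push_cast; linarith)
    have qb := Real.rpow_pos_of_pos (by linarith : 0 < q) β
    rw [div_le_iff₀ hD]
    calc R (q * t) - R t ≤ ((n + 1 : ℕ) : ℝ) * (Real.exp (2 * ε) * q ^ β * (t ^ β * ℓ t)) := by linarith
      _ ≤ ((q - 1) * t + 1) * (Real.exp (2 * ε) * q ^ β * (t ^ β * ℓ t)) := by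
        gcongr; push_cast; linarith
      _ = _ := by field_simp
  · have s1 := steps_le (fun x => - R x) t (-(Real.exp (-(2 * ε)) * (t ^ β * ℓ t))) n (by
      intro i hi
      have : (i : ℝ) ≤ n := by exact_mod_cast hi.le
      have i0 : (0 : ℝ) ≤ i := i.cast_nonneg
      have := (key (t + i) (by linarith) (by linarith)).2
      linarith)
    have s2 : R (t + n) ≤ R (q * t) := hR (by linarith)
    rw [le_div_iff₀ hD]
    calc (q - 1 - 1 / t) * Real.exp (-(2 * ε)) * (t * (t ^ β * ℓ t))
        = ((q - 1) * t - 1) * (Real.exp (-(2 * ε)) * (t ^ β * ℓ t)) := by field_simp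
      _ ≤ n * (Real.exp (-(2 * ε)) * (t ^ β * ℓ t)) := by gcongr; linarith
      _ ≤ _ := by linarith

theorem incr_upper (R ℓ : ℝ → ℝ) (β : ℝ) (hβ : 0 ≤ β) (hR : Monotone R) (hℓ : ∀ s > 0, 0 < ℓ s)
    (hsv : ∀ c > 0, Tendsto (fun x => ℓ (c * x) / ℓ x) atTop (𝓝 1))
    (h6 : ∀ h, Tendsto (fun s => (R (s + h) - R s) / (s ^ β * ℓ s)) atTop (𝓝 h))
    (q : ℝ) (hq : 1 < q) (E : ℝ) (hE : (q - 1) * q ^ β < E) :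
    ∀ᶠ t in atTop, (R (q * t) - R t) / (t * (t ^ β * ℓ t)) ≤ E := by
  have c : Tendsto (fun ε : ℝ => (q - 1) * (Real.exp (2 * ε) * q ^ β)) (𝓝[>] 0) (𝓝 ((q - 1) * q ^ β)) := by
    have : ContinuousAt (fun ε : ℝ => (q - 1) * (Real.exp (2 * ε) * q ^ β)) 0 := by fun_prop
    simpa [ContinuousAt] using this.mono_left (nhdsWithin_le_nhds (s := Set.Ioi 0))
  obtain ⟨ε, h1, hε⟩ := ((c.eventually (gt_mem_nhds hE)).and self_mem_nhdsWithin).exists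
  have d : Tendsto (fun t : ℝ => (q - 1 + 1 / t) * (Real.exp (2 * ε) * q ^ β)) atTop
      (𝓝 ((q - 1 + 0) * (Real.exp (2 * ε) * q ^ β))) := by
    refine Tendsto.mul_const _ (Tendsto.const_add _ ?_)
    have h0 : Tendsto (fun t : ℝ => 1 / t) atTop (𝓝 0) := by
      simpa only [one_div] using tendsto_inv_atTop_zero (𝕜 := ℝ)
    exact h0
  rw [add_zero] at d
  filter_upwards [d.eventually (gt_mem_nhds h1), incr_bounds R ℓ β hβ hR hℓ hsv h6 q hq ε hε] with t a b
  exact b.1.trans a.le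

theorem incr_lower (R ℓ : ℝ → ℝ) (β : ℝ) (hβ : 0 ≤ β) (hR : Monotone R) (hℓ : ∀ s > 0, 0 < ℓ s)
    (hsv : ∀ c > 0, Tendsto (fun x => ℓ (c * x) / ℓ x) atTop (𝓝 1))
    (h6 : ∀ h, Tendsto (fun s => (R (s + h) - R s) / (s ^ β * ℓ s)) atTop (𝓝 h))
    (q : ℝ) (hq : 1 < q) (E : ℝ) (hE : E < q - 1) :
    ∀ᶠ t in atTop, E ≤ (R (q * t) - R t) / (t * (t ^ β * ℓ t)) := by
  have c : Tendsto (fun ε : ℝ => (q - 1) * Real.exp (-(2 * ε))) (𝓝[>] 0) (𝓝 (q - 1)) := by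
    have : ContinuousAt (fun ε : ℝ => (q - 1) * Real.exp (-(2 * ε))) 0 := by fun_prop
    simpa [ContinuousAt] using this.mono_left (nhdsWithin_le_nhds (s := Set.Ioi 0))
  obtain ⟨ε, h1, hε⟩ := ((c.eventually (lt_mem_nhds hE)).and self_mem_nhdsWithin).exists
  have d : Tendsto (fun t : ℝ => (q - 1 - 1 / t) * Real.exp (-(2 * ε))) atTop
      (𝓝 ((q - 1 - 0) * Real.exp (-(2 * ε)))) := by
    refine Tendsto.mul_const _ (Tendsto.const_sub _ ?_)
    have h0 : Tendsto (fun t : ℝ => 1 / t) atTop (𝓝 0) := by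
      simpa only [one_div] using tendsto_inv_atTop_zero (𝕜 := ℝ)
    exact h0
  rw [sub_zero] at d
  filter_upwards [d.eventually (lt_mem_nhds h1), incr_bounds R ℓ β hβ hR hℓ hsv h6 q hq ε hε] with t a b
  exact a.le.trans b.2

theorem contract (w : ℝ → ℝ) (q θ S M : ℝ) (hq : 1 < q) (hθ0 : 0 < θ) (hθ : θ < 1) (hS : 0 < S)
    (hM : ∀ s, S ≤ s → s ≤ q * S → w s ≤ M) (hw : ∀ t ≥ S, w (q * t) ≤ θ * w t)
    (ε : ℝ) (hε : 0 < ε) : ∀ᶠ s in atTop, w s ≤ ε := by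
  have q0 : 0 < q := by linarith
  have step : ∀ n : ℕ, ∀ s, q ^ n * S ≤ s → s ≤ q ^ (n + 1) * S → w s ≤ θ ^ n * max M 0 := by
    intro n
    induction n with
    | zero =>
      intro s h1 h2
      simp only [pow_zero, one_mul, zero_add, pow_one] at *
      exact (hM s h1 h2).trans (le_max_left _ _)
    | succ n ih =>
      intro s h1 h2
      have e : q * (s / q) = s := by field_simp
      have h3 : q ^ n * S ≤ s / q := by
        rw [le_div_iff₀ q0]; rw [pow_succ] at h1; linarith
      have h4 : s / q ≤ q ^ (n + 1) * S := by
        rw [div_le_iff₀ q0]; rw [pow_succ] at h2; linarith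
      have h5 := ih _ h3 h4
      have h6 : S ≤ s / q := le_trans (le_mul_of_one_le_left hS.le (one_le_pow₀ hq.le)) h3
      have h7 := hw _ h6
      rw [e] at h7
      calc w s ≤ θ * w (s / q) := h7
        _ ≤ θ * (θ ^ n * max M 0) := by gcongr
        _ = _ := by ring
  have tn : Tendsto (fun n : ℕ => θ ^ n * max M 0) atTop (𝓝 (0 * max M 0)) :=
    (tendsto_pow_atTop_nhds_zero_of_lt_one hθ0.le hθ).mul_const _
  rw [zero_mul] at tn
  obtain ⟨n₀, hn₀⟩ := eventually_atTop.1 (tn.eventually (gt_mem_nhds hε))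
  filter_upwards [eventually_ge_atTop (q ^ n₀ * S)] with s hs
  have hs1 : 1 ≤ s / S := by
    rw [le_div_iff₀ hS, one_mul]
    exact le_trans (le_mul_of_one_le_left hS.le (one_le_pow₀ hq.le)) hs
  obtain ⟨n, hn1, hn2⟩ := exists_nat_pow_near hs1 hq
  rw [le_div_iff₀ hS] at hn1
  rw [div_lt_iff₀ hS] at hn2
  have : n₀ ≤ n := by
    by_contra hc
    have : q ^ (n + 1) ≤ q ^ n₀ := pow_le_pow_right₀ hq.le (by omega)
    have := mul_le_mul_of_nonneg_right this hS.le
    linarith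
  exact (step n s hn1 hn2.le).trans (hn₀ n this).le

theorem ratio_lim (α : ℝ) (hα : 0 < α) :
    Tendsto (fun q : ℝ => (q - 1) / (q ^ α - 1)) (𝓝[>] 1) (𝓝 (1 / α)) := by
  have h : HasDerivAt (fun q : ℝ => q ^ α) (α * 1 ^ (α - 1)) 1 :=
    Real.hasDerivAt_rpow_const (Or.inl one_ne_zero)
  rw [Real.one_rpow, mul_one] at h
  have h2 := (h.tendsto_slope.mono_left (nhdsWithin_mono 1
    (fun x hx => (ne_of_gt hx : x ≠ 1)) : 𝓝[>] (1 : ℝ) ≤ 𝓝[≠] 1)).inv₀ hα.ne'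
  rw [one_div]
  refine h2.congr (fun q => ?_)
  rw [slope_def_field, inv_div, Real.one_rpow]

theorem base_lim (R ℓ : ℝ → ℝ) (β : ℝ) (hβ : 0 ≤ β) (hR : Monotone R) (hℓ : ∀ s > 0, 0 < ℓ s)
    (hR0 : ∀ s, 0 ≤ R s) (hRint : ∀ s, ∃ n : ℕ, R s = n)
    (hsv : ∀ c > 0, Tendsto (fun x => ℓ (c * x) / ℓ x) atTop (𝓝 1))
    (h6 : ∀ h, Tendsto (fun s => (R (s + h) - R s) / (s ^ β * ℓ s)) atTop (𝓝 h)) :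
    Tendsto (fun s => R s / (s * (s ^ β * ℓ s))) atTop (𝓝 (1 / (β + 1))) := by
  set α := β + 1 with hα
  have hα0 : 0 < α := by linarith
  have hG : ∀ s > 0, 0 < s ^ β * ℓ s := fun s hs => mul_pos (Real.rpow_pos_of_pos hs _) (hℓ s hs)
  set a : ℝ → ℝ := fun s => R s / (s * (s ^ β * ℓ s)) with ha
  have ha0 : ∀ s > 0, 0 ≤ a s := fun s hs => div_nonneg (hR0 s) (mul_pos hs (hG s hs)).le
  -- lower bound on G
  have Glow : ∀ᶠ s in atTop, 1 / 2 ≤ s ^ β * ℓ s := by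
    have E1 := (h6 1).eventually (lt_mem_nhds (one_pos))
    have E2 := (h6 1).eventually (gt_mem_nhds (one_lt_two))
    filter_upwards [E1, E2, eventually_gt_atTop 0] with s h1 h2 h3
    have g := hG s h3
    rw [lt_div_iff₀ g, zero_mul] at h1
    rw [div_lt_iff₀ g] at h2
    obtain ⟨n, hn⟩ := hRint (s + 1)
    obtain ⟨m, hm⟩ := hRint s
    rw [hn, hm] at h1 h2
    have : m + 1 ≤ n := by
      have : (m : ℝ) < n := by linarith
      exact_mod_cast this
    have : (m : ℝ) + 1 ≤ n := by exact_mod_cast this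
    linarith
  -- the ratio
  have hth : ∀ q > 1, Tendsto (fun t => (t * (t ^ β * ℓ t)) / ((q * t) * ((q * t) ^ β * ℓ (q * t)))) atTop
      (𝓝 ((q ^ α)⁻¹)) := by
    intro q hq
    have q0 : 0 < q := by linarith
    have h1 := ((hsv q q0).inv₀ one_ne_zero).const_mul ((q ^ α)⁻¹)
    rw [inv_one, mul_one] at h1
    refine h1.congr' ?_
    filter_upwards [eventually_gt_atTop 0] with t ht
    have := hℓ t ht
    have := hℓ (q * t) (by positivity)
    have tb := Real.rpow_pos_of_pos ht β
    have qb := Real.rpow_pos_of_pos q0 β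
    rw [hα, Real.rpow_add q0, Real.rpow_one, Real.mul_rpow q0.le ht.le]
    field_simp
  have hrec : ∀ q > 1, ∀ t > 0, a (q * t) = (t * (t ^ β * ℓ t)) / ((q * t) * ((q * t) ^ β * ℓ (q * t))) *
      (a t + (R (q * t) - R t) / (t * (t ^ β * ℓ t))) := by
    intro q hq t ht
    have := hG t ht
    have := hG (q * t) (by positivity)
    simp only [ha]
    generalize ht1 : t ^ β * ℓ t = g1 at *
    generalize ht2 : (q * t) ^ β * ℓ (q * t) = g2 at *
    field_simp
    ring
  have rl := ratio_lim α hα0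
  have upper : ∀ η > 0, ∀ᶠ s in atTop, a s ≤ 1 / α + η + η := by
    intro η hη
    set y := 1 / α + η with hy
    have rl2 : Tendsto (fun q : ℝ => (q - 1) * q ^ β / (q ^ α - 1)) (𝓝[>] 1) (𝓝 (1 / α)) := by
      have c : Tendsto (fun q : ℝ => q ^ β) (𝓝[>] 1) (𝓝 1) := by
        have : ContinuousAt (fun q : ℝ => q ^ β) 1 := Real.continuousAt_rpow_const _ _ (Or.inl one_ne_zero)
        simpa [ContinuousAt] using this.mono_left (nhdsWithin_le_nhds (s := Set.Ioi 1))
      have := rl.mul c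
      rw [mul_one] at this
      refine this.congr (fun q => by ring)
    obtain ⟨q, hq1, hq⟩ := ((rl2.eventually (gt_mem_nhds (by linarith : 1 / α < y))).and
      self_mem_nhdsWithin).exists
    have hq : 1 < q := hq
    have qa : 1 < q ^ α := Real.one_lt_rpow hq hα0
    rw [div_lt_iff₀ (by linarith)] at hq1
    have hlt : (q ^ α)⁻¹ * (y + (q - 1) * q ^ β) < y := by
      rw [inv_mul_lt_iff₀ (by linarith)]; linarith
    obtain ⟨δ, ⟨hδ1, hδ2⟩, hδ⟩ : ∃ δ : ℝ, (((q ^ α)⁻¹ + δ) * (y + ((q - 1) * q ^ β + δ)) < y ∧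
        (q ^ α)⁻¹ + δ < 1) ∧ 0 < δ := by
      have c1 : ContinuousAt (fun δ : ℝ => ((q ^ α)⁻¹ + δ) * (y + ((q - 1) * q ^ β + δ))) 0 := by fun_prop
      have c2 : ContinuousAt (fun δ : ℝ => (q ^ α)⁻¹ + δ) 0 := by fun_prop
      have e1 := c1.eventually (gt_mem_nhds (by simpa using hlt))
      have e2 := c2.eventually (gt_mem_nhds (show (q ^ α)⁻¹ + 0 < 1 by simpa using inv_lt_one_of_one_lt₀ qa))
      exact (((e1.and e2).filter_mono nhdsWithin_le_nhds).and
        (self_mem_nhdsWithin (s := Set.Ioi (0 : ℝ)))).exists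
    have hinv : 0 < (q ^ α)⁻¹ := by positivity
    set θ := (q ^ α)⁻¹ + δ with hθ
    have I1 := incr_upper R ℓ β hβ hR hℓ hsv h6 q hq ((q - 1) * q ^ β + δ) (by linarith)
    have I2 := (hth q hq).eventually (gt_mem_nhds (by linarith : (q ^ α)⁻¹ < θ))
    obtain ⟨S, hS⟩ := eventually_atTop.1 (I1.and (I2.and (Glow.and (eventually_ge_atTop 1))))
    set S' := max S 1
    have SS : S ≤ S' := le_max_left _ _
    have S1 : 1 ≤ S' := le_max_right _ _
    have := contract (fun s => a s - y) q θ S' (R (q * S') * 2) hq (by linarith) hδ2 (by linarith) ?_ ?_ η hη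
    · filter_upwards [this] with s hs
      linarith
    · intro s h1 h2
      obtain ⟨-, -, g, s1⟩ := hS s (SS.trans h1)
      have hD : 1 / 2 ≤ s * (s ^ β * ℓ s) := by nlinarith
      have : a s ≤ R (q * S') * 2 := by
        simp only [ha]
        rw [div_le_iff₀ (by linarith)]
        have r1 := hR h2
        have r2 := hR0 s
        nlinarith
      have hy0 : 0 < y := by positivity
      linarith
    · intro t ht
      obtain ⟨i1, i2, -, t1⟩ := hS t (SS.trans ht)
      have t0 : 0 < t := by linarith
      have at0 := ha0 t t0
      have inc0 : 0 ≤ (R (q * t) - R t) / (t * (t ^ β * ℓ t)) :=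
        div_nonneg (sub_nonneg.2 (hR (by nlinarith))) (mul_pos t0 (hG t t0)).le
      have : a (q * t) ≤ θ * (a t + ((q - 1) * q ^ β + δ)) := by
        rw [hrec q hq t t0]
        have : 0 ≤ θ := by linarith
        gcongr
      have e : θ * (a t + ((q - 1) * q ^ β + δ)) = θ * (y + ((q - 1) * q ^ β + δ)) + θ * (a t - y) := by ring
      linarith
  have lower : ∀ η > 0, ∀ᶠ s in atTop, 1 / α - η - η ≤ a s := by
    intro η hη
    set y := 1 / α - η with hy
    obtain ⟨q, hq1, hq⟩ := ((rl.eventually (lt_mem_nhds (by linarith : y < 1 / α))).and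
      self_mem_nhdsWithin).exists
    have hq : 1 < q := hq
    have qa : 1 < q ^ α := Real.one_lt_rpow hq hα0
    rw [lt_div_iff₀ (by linarith)] at hq1
    have hlt : y < (q ^ α)⁻¹ * (y + (q - 1)) := by
      rw [lt_inv_mul_iff₀ (by linarith)]; linarith
    have hinv : 0 < (q ^ α)⁻¹ := by positivity
    obtain ⟨δ, ⟨hδ1, hδ2⟩, hδ⟩ : ∃ δ : ℝ, (y < ((q ^ α)⁻¹ - δ) * (y + ((q - 1) - δ)) ∧
        0 < (q ^ α)⁻¹ - δ) ∧ 0 < δ := by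
      have c1 : ContinuousAt (fun δ : ℝ => ((q ^ α)⁻¹ - δ) * (y + ((q - 1) - δ))) 0 := by fun_prop
      have c2 : ContinuousAt (fun δ : ℝ => (q ^ α)⁻¹ - δ) 0 := by fun_prop
      have e1 := c1.eventually (lt_mem_nhds (by simpa using hlt))
      have e2 := c2.eventually (lt_mem_nhds (a := 0) (by simpa using hinv))
      exact (((e1.and e2).filter_mono nhdsWithin_le_nhds).and
        (self_mem_nhdsWithin (s := Set.Ioi (0 : ℝ)))).exists
    have hinv1 := inv_lt_one_of_one_lt₀ qa
    set θ := (q ^ α)⁻¹ - δ with hθ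
    have I1 := incr_lower R ℓ β hβ hR hℓ hsv h6 q hq ((q - 1) - δ) (by linarith)
    have I2 := (hth q hq).eventually (lt_mem_nhds (by linarith : θ < (q ^ α)⁻¹))
    obtain ⟨S, hS⟩ := eventually_atTop.1 (I1.and I2)
    set S' := max S 1
    have SS : S ≤ S' := le_max_left _ _
    have S1 : 1 ≤ S' := le_max_right _ _
    have := contract (fun s => y - a s) q θ S' y hq hδ2 (by linarith) (by linarith) ?_ ?_ η hη
    · filter_upwards [this] with s hs
      linarith
    · intro s h1 h2
      linarith [ha0 s (by linarith)]
    · intro t ht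
      obtain ⟨i1, i2⟩ := hS t (SS.trans ht)
      have t0 : 0 < t := by linarith
      have at0 := ha0 t t0
      have inc0 : 0 ≤ (R (q * t) - R t) / (t * (t ^ β * ℓ t)) :=
        div_nonneg (sub_nonneg.2 (hR (by nlinarith))) (mul_pos t0 (hG t t0)).le
      have : θ * (a t + ((q - 1) - δ)) ≤ a (q * t) := by
        rw [hrec q hq t t0]
        calc θ * (a t + ((q - 1) - δ)) ≤ θ * (a t + (R (q * t) - R t) / (t * (t ^ β * ℓ t))) := by gcongr
          _ ≤ _ := by gcongr
      have e : θ * (a t + ((q - 1) - δ)) = θ * (y + ((q - 1) - δ)) + θ * (a t - y) := by ring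
      linarith
  rw [Metric.tendsto_nhds]
  intro η hη
  filter_upwards [upper (η / 4) (by positivity), lower (η / 4) (by positivity)] with s h1 h2
  rw [Real.dist_eq, abs_lt]
  constructor <;> linarith

theorem cell_bounds (γ α a b : ℝ) (hγ : 0 ≤ γ) (hα : 1 ≤ α) (ha : 0 ≤ a) (hab : a ≤ b) (hb : b ≤ 1) :
    (1 - b) ^ γ * (b ^ α - a ^ α) ≤ ∫ x in a..b, (1 - x) ^ γ * (α * x ^ (α - 1)) ∧
    (∫ x in a..b, (1 - x) ^ γ * (α * x ^ (α - 1))) ≤ (1 - a) ^ γ * (b ^ α - a ^ α) ∧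
    b ^ α - a ^ α ≤ α * (b - a) := by
  have c1 : Continuous (fun x : ℝ => (1 - x) ^ γ) :=
    (by fun_prop : Continuous (fun x : ℝ => 1 - x)).rpow_const (fun x => Or.inr hγ)
  have c2 : Continuous (fun x : ℝ => α * x ^ (α - 1)) :=
    (continuous_id.rpow_const (fun x => Or.inr (by linarith))).const_mul α
  have e : ∫ x in a..b, α * x ^ (α - 1) = b ^ α - a ^ α := by
    rw [intervalIntegral.integral_const_mul, integral_rpow (Or.inl (by linarith)), sub_add_cancel]
    field_simp
  refine ⟨?_, ?_, ?_⟩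
  · rw [← e, ← intervalIntegral.integral_const_mul]
    refine intervalIntegral.integral_mono_on hab ((c2.const_mul _).intervalIntegrable _ _)
      ((c1.mul c2).intervalIntegrable _ _) (fun x hx => ?_)
    have x0 : 0 ≤ x := ha.trans hx.1
    have : 0 ≤ α * x ^ (α - 1) := by positivity
    exact mul_le_mul_of_nonneg_right
      (Real.rpow_le_rpow (by linarith) (by linarith [hx.2]) hγ) this
  · rw [← e, ← intervalIntegral.integral_const_mul]
    refine intervalIntegral.integral_mono_on hab 
      ((c1.mul c2).intervalIntegrable _ _) ((c2.const_mul _).intervalIntegrable _ _) (fun x hx => ?_)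
    have x0 : 0 ≤ x := ha.trans hx.1
    have : 0 ≤ α * x ^ (α - 1) := by positivity
    exact mul_le_mul_of_nonneg_right
      (Real.rpow_le_rpow (by linarith [hx.2]) (by linarith [hx.1]) hγ) this
  · rw [← e]
    have : ∫ x in a..b, α = α * (b - a) := by simp [mul_comm]
    rw [← this]
    refine intervalIntegral.integral_mono_on hab (c2.intervalIntegrable _ _)
      (continuous_const.intervalIntegrable _ _) (fun x hx => ?_)
    have x0 : 0 ≤ x := ha.trans hx.1
    have : x ^ (α - 1) ≤ 1 := Real.rpow_le_one x0 (by linarith [hx.2]) (by linarith)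
    nlinarith

theorem beta_real (γ α : ℝ) (hγ : 0 ≤ γ) (hα : 1 ≤ α) :
    ∫ x in (0 : ℝ)..1, (1 - x) ^ γ * (α * x ^ (α - 1)) =
      α * (Real.Gamma (γ + 1) * Real.Gamma α / Real.Gamma (γ + 1 + α)) := by
  have h := ProbabilityTheory.beta_eq_betaIntegralReal α (γ + 1) (by linarith) (by linarith)
  have h2 : Complex.betaIntegral (α : ℂ) ((γ + 1 : ℝ) : ℂ) =
      ((∫ x in (0 : ℝ)..1, x ^ (α - 1) * (1 - x) ^ γ : ℝ) : ℂ) := by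
    rw [Complex.betaIntegral, ← intervalIntegral.integral_ofReal]
    refine intervalIntegral.integral_congr (fun x hx => ?_)
    rw [Set.uIcc_of_le zero_le_one] at hx
    push_cast
    rw [Complex.ofReal_cpow hx.1, Complex.ofReal_cpow (by linarith [hx.2])]
    push_cast
    congr 2
    ring
  rw [h2, Complex.ofReal_re, ProbabilityTheory.beta] at h
  rw [show γ + 1 + α = α + (γ + 1) by ring, mul_comm (Real.Gamma (γ + 1)), h,
    ← intervalIntegral.integral_const_mul]
  refine intervalIntegral.integral_congr (fun x _ => ?_)
  ring

theorem riemann_bounds (γ α : ℝ) (hγ : 0 ≤ γ) (hα : 1 ≤ α) (n : ℕ) (hn : 0 < n) :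
    let I := α * (Real.Gamma (γ + 1) * Real.Gamma α / Real.Gamma (γ + 1 + α))
    I - α / n ≤ ∑ i ∈ Finset.range n, (1 - ((i : ℝ) + 1) / n) ^ γ *
        ((((i : ℝ) + 1) / n) ^ α - ((i : ℝ) / n) ^ α) ∧
    ∑ i ∈ Finset.range n, (1 - (i : ℝ) / n) ^ γ *
        ((((i : ℝ) + 1) / n) ^ α - ((i : ℝ) / n) ^ α) ≤ I + α / n := by
  intro I
  have n0 : (0 : ℝ) < n := by exact_mod_cast hn
  have c1 : Continuous (fun x : ℝ => (1 - x) ^ γ) :=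
    (by fun_prop : Continuous (fun x : ℝ => 1 - x)).rpow_const (fun x => Or.inr hγ)
  have c2 : Continuous (fun x : ℝ => α * x ^ (α - 1)) :=
    (continuous_id.rpow_const (fun x => Or.inr (by linarith))).const_mul α
  have hI : ∑ i ∈ Finset.range n, ∫ x in ((i : ℝ) / n)..(((i : ℝ) + 1) / n),
      (1 - x) ^ γ * (α * x ^ (α - 1)) = I := by
    have := intervalIntegral.sum_integral_adjacent_intervals (μ := MeasureTheory.volume)
      (f := fun x : ℝ => (1 - x) ^ γ * (α * x ^ (α - 1))) (a := fun i : ℕ => (i : ℝ) / n) (n := n)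
      (fun k _ => (c1.mul c2).intervalIntegrable _ _)
    simp only [Nat.cast_add, Nat.cast_one, Nat.cast_zero, zero_div, div_self n0.ne'] at this
    rw [this, beta_real γ α hγ hα]
  have cell : ∀ i ∈ Finset.range n, _ := fun i hi =>
    cell_bounds γ α ((i : ℝ) / n) (((i : ℝ) + 1) / n) hγ hα (by positivity) (by gcongr; linarith)
      (by
        rw [div_le_one n0]
        have := Finset.mem_range.1 hi
        exact_mod_cast this)
  have lo := Finset.sum_le_sum (fun i hi => (cell i hi).1)
  have up := Finset.sum_le_sum (fun i hi => (cell i hi).2.1)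
  rw [hI] at lo up
  have diff : ∑ i ∈ Finset.range n, (1 - (i : ℝ) / n) ^ γ *
        ((((i : ℝ) + 1) / n) ^ α - ((i : ℝ) / n) ^ α) -
      ∑ i ∈ Finset.range n, (1 - ((i : ℝ) + 1) / n) ^ γ *
        ((((i : ℝ) + 1) / n) ^ α - ((i : ℝ) / n) ^ α) ≤ α / n := by
    rw [← Finset.sum_sub_distrib]
    calc _ ≤ ∑ i ∈ Finset.range n, (α / n) * ((1 - (i : ℝ) / n) ^ γ - (1 - ((i : ℝ) + 1) / n) ^ γ) := by
          refine Finset.sum_le_sum (fun i hi => ?_)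
          have h3 := (cell i hi).2.2
          have e : α * (((i : ℝ) + 1) / n - (i : ℝ) / n) = α / n := by field_simp; ring
          rw [e] at h3
          rw [← sub_mul, mul_comm]
          refine mul_le_mul_of_nonneg_right h3 (sub_nonneg.2 ?_)
          have hi' : (i : ℝ) + 1 ≤ n := by exact_mod_cast Finset.mem_range.1 hi
          refine Real.rpow_le_rpow ?_ ?_ hγ
          · rw [sub_nonneg, div_le_one n0]; exact hi'
          · gcongr; linarith
      _ = (α / n) * (1 - 0 ^ γ) := by
          rw [← Finset.mul_sum]
          congr 1
          have := Finset.sum_range_sub' (fun i : ℕ => (1 - (i : ℝ) / n) ^ γ) n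
          simpa [div_self n0.ne'] using this
      _ ≤ α / n := by
          have : (0 : ℝ) ≤ 0 ^ γ := Real.rpow_nonneg le_rfl _
          have : 0 ≤ α / n := by positivity
          nlinarith
  constructor <;> linarith

theorem p_summable (p : ℕ → ℝ) (hp1 : ∑' k, p k = 1) : Summable p := by
  by_contra h
  rw [tsum_eq_zero_of_not_summable h] at hp1
  exact zero_ne_one hp1

theorem p_lt_one (p : ℕ → ℝ) (hp0 : ∀ k, 0 ≤ p k) (hp1 : ∑' k, p k = 1)
    (hpinf : {k | 0 < p k}.Infinite) (k : ℕ) : p k < 1 := by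
  obtain ⟨m, hm, hmk⟩ := hpinf.exists_notMem_finset {k}
  have h := (p_summable p hp1).sum_le_tsum {k, m} (fun i _ => hp0 i)
  have hne : k ≠ m := fun h => hmk (by simp [h])
  rw [Finset.sum_pair hne, hp1] at h
  have : 0 < p m := hm
  linarith

theorem K_finite (p : ℕ → ℝ) (hp1 : ∑' k, p k = 1) (s : ℝ) :
    {k | 1 / Real.exp s ≤ p k}.Finite := by
  have h := (p_summable p hp1).tendsto_cofinite_zero
  have h2 := h.eventually (gt_mem_nhds (by positivity : 0 < 1 / Real.exp s))
  rw [Filter.eventually_cofinite] at h2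
  simpa only [not_lt] using h2

theorem prodP_succ (p : ℕ → ℝ) (j : ℕ) (r : Fin (j + 1) → ℕ) :
    prodP p (j + 1) r = p (r 0) * prodP p j (Fin.tail r) := by
  simp [prodP, Fin.prod_univ_succ, Fin.tail]

theorem prodP_nonneg (p : ℕ → ℝ) (hp0 : ∀ k, 0 ≤ p k) (j : ℕ) (r : Fin j → ℕ) : 0 ≤ prodP p j r :=
  Finset.prod_nonneg (fun _ _ => hp0 _)

theorem prodP_le_one (p : ℕ → ℝ) (hp0 : ∀ k, 0 ≤ p k) (hlt : ∀ k, p k < 1) (j : ℕ) (r : Fin j → ℕ) :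
    prodP p j r ≤ 1 :=
  Finset.prod_le_one (fun _ _ => hp0 _) (fun _ _ => (hlt _).le)

theorem split_iff (p : ℕ → ℝ) (s : ℝ) (k : ℕ) (hk : 0 < p k) (P : ℝ) :
    1 / Real.exp (s + Real.log (p k)) ≤ P ↔ 1 / Real.exp s ≤ p k * P := by
  rw [Real.exp_add, Real.exp_log hk, div_le_iff₀ (by positivity), div_le_iff₀ (by positivity)]
  constructor <;> intro h <;> linarith

/-- Splitting off the first coordinate. -/
noncomputable def splitEquiv (p : ℕ → ℝ) (hp0 : ∀ k, 0 ≤ p k) (hlt : ∀ k, p k < 1) (j : ℕ) (s : ℝ)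
    (K : Finset ℕ) (hK : ∀ k, k ∈ K ↔ 1 / Real.exp s ≤ p k) :
    {r : Fin (j + 1) → ℕ // 1 / Real.exp s ≤ prodP p (j + 1) r} ≃
      Σ k : K, {r : Fin j → ℕ // 1 / Real.exp (s + Real.log (p k)) ≤ prodP p j r} where
  toFun r :=
    have hk : 1 / Real.exp s ≤ p (r.1 0) := by
      have h := r.2
      rw [prodP_succ] at h
      have h1 := prodP_le_one p hp0 hlt j (Fin.tail r.1)
      have h2 := hp0 (r.1 0)
      nlinarith
    ⟨⟨r.1 0, (hK _).2 hk⟩, ⟨Fin.tail r.1, by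
      rw [split_iff p s _ (lt_of_lt_of_le (by positivity) hk), ← prodP_succ]
      exact r.2⟩⟩
  invFun x := ⟨Fin.cons x.1.1 x.2.1, by
    have hk := (hK _).1 x.1.2
    have h := x.2.2
    rw [split_iff p s _ (lt_of_lt_of_le (by positivity) hk)] at h
    rw [prodP_succ]
    simpa using h⟩
  left_inv r := by
    ext i
    simp
  right_inv x := by
    obtain ⟨⟨k, hk⟩, ⟨r, hr⟩⟩ := x
    rfl

theorem F_finite (p : ℕ → ℝ) (hp0 : ∀ k, 0 ≤ p k) (hp1 : ∑' k, p k = 1) (hlt : ∀ k, p k < 1)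
    (j : ℕ) : ∀ s : ℝ, Finite {r : Fin j → ℕ // 1 / Real.exp s ≤ prodP p j r} := by
  induction j with
  | zero => intro s; infer_instance
  | succ j ih =>
    intro s
    have := fun s => ih s
    exact Finite.of_equiv _ (splitEquiv p hp0 hlt j s (K_finite p hp1 s).toFinset (by simp)).symm

theorem rho_succ (p : ℕ → ℝ) (hp0 : ∀ k, 0 ≤ p k) (hp1 : ∑' k, p k = 1) (hlt : ∀ k, p k < 1)
    (j : ℕ) (s : ℝ) (K : Finset ℕ) (hK : ∀ k, k ∈ K ↔ 1 / Real.exp s ≤ p k) :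
    rhoJ p (j + 1) (Real.exp s) = ∑ k ∈ K, rhoJ p j (Real.exp (s + Real.log (p k))) := by
  have := F_finite p hp0 hp1 hlt j
  unfold rhoJ
  rw [Nat.card_congr (splitEquiv p hp0 hlt j s K hK), Nat.card_sigma, Nat.cast_sum,
    ← Finset.sum_coe_sort K]

theorem rho_mono (p : ℕ → ℝ) (hp0 : ∀ k, 0 ≤ p k) (hp1 : ∑' k, p k = 1) (hlt : ∀ k, p k < 1)
    (j : ℕ) : Monotone (fun s => rhoJ p j (Real.exp s)) := by
  intro s t hst
  have := F_finite p hp0 hp1 hlt j t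
  simp only [rhoJ]
  have h : 1 / Real.exp t ≤ 1 / Real.exp s := by gcongr
  exact_mod_cast Nat.card_le_card_of_injective
    (fun r : {r : Fin j → ℕ // 1 / Real.exp s ≤ prodP p j r} =>
      (⟨r.1, h.trans r.2⟩ : {r : Fin j → ℕ // 1 / Real.exp t ≤ prodP p j r}))
    (fun a b hab => Subtype.ext (congrArg (fun x => x.1) hab))

theorem rho_zero (p : ℕ → ℝ) (s : ℝ) (hs : 0 ≤ s) : rhoJ p 0 (Real.exp s) = 1 := by
  have h : 1 / Real.exp s ≤ 1 := by
    rw [div_le_one (Real.exp_pos _)]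
    exact Real.one_le_exp hs
  have h1 : Nat.card {r : Fin 0 → ℕ // 1 / Real.exp s ≤ prodP p 0 r} = 1 :=
    Nat.card_eq_one_iff_unique.2 ⟨inferInstance, ⟨⟨Fin.elim0, by simpa [prodP] using h⟩⟩⟩
  rw [rhoJ, h1, Nat.cast_one]

theorem rho_one (p : ℕ → ℝ) (hp0 : ∀ k, 0 ≤ p k) (hp1 : ∑' k, p k = 1) (hlt : ∀ k, p k < 1)
    (s : ℝ) (K : Finset ℕ) (hK : ∀ k, k ∈ K ↔ 1 / Real.exp s ≤ p k) :
    rhoJ p 1 (Real.exp s) = K.card := by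
  rw [rho_succ p hp0 hp1 hlt 0 s K hK, Finset.sum_congr rfl (g := fun _ => (1 : ℝ))]
  · simp
  · intro k hk
    apply rho_zero
    have h := (hK k).1 hk
    have h2 := Real.log_le_log (by positivity) h
    rw [one_div, Real.log_inv, Real.log_exp] at h2
    linarith

theorem rho_at_zero (p : ℕ → ℝ) (hp0 : ∀ k, 0 ≤ p k) (hp1 : ∑' k, p k = 1) (hlt : ∀ k, p k < 1)
    (j : ℕ) (hj : 1 ≤ j) : rhoJ p j (Real.exp 0) = 0 := by
  obtain ⟨j, rfl⟩ := Nat.exists_eq_add_of_le' hj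
  rw [rho_succ p hp0 hp1 hlt j 0 ∅]
  · simp
  · intro k
    simpa using hlt k

theorem conv_bounds (p : ℕ → ℝ) (hp0 : ∀ k, 0 ≤ p k) (hp1 : ∑' k, p k = 1) (hlt : ∀ k, p k < 1)
    (j : ℕ) (s : ℝ) (hs : 0 ≤ s) (n : ℕ) (hn : 0 < n) :
    rhoJ p (j + 1) (Real.exp s) ≤ ∑ i ∈ Finset.range n,
      rhoJ p j (Real.exp (s * (1 - (i : ℝ) / n))) *
      (rhoJ p 1 (Real.exp (s * (((i : ℝ) + 1) / n))) - rhoJ p 1 (Real.exp (s * ((i : ℝ) / n)))) ∧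
    ∑ i ∈ Finset.range n,
      rhoJ p j (Real.exp (s * (1 - ((i : ℝ) + 1) / n))) *
      (rhoJ p 1 (Real.exp (s * (((i : ℝ) + 1) / n))) - rhoJ p 1 (Real.exp (s * ((i : ℝ) / n)))) ≤
    rhoJ p (j + 1) (Real.exp s) := by
  have n0 : (0 : ℝ) < n := by exact_mod_cast hn
  let K : ℝ → Finset ℕ := fun s => (K_finite p hp1 s).toFinset
  have hK : ∀ s k, k ∈ K s ↔ 1 / Real.exp s ≤ p k := fun s k => by simp [K]
  have hKlog : ∀ s k, k ∈ K s → -s ≤ Real.log (p k) := by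
    intro s k hk
    have h2 := Real.log_le_log (by positivity) ((hK s k).1 hk)
    rwa [one_div, Real.log_inv, Real.log_exp] at h2
  have hKlog' : ∀ s t k, k ∈ K t → k ∉ K s → Real.log (p k) ≤ -s := by
    intro s t k hk hks
    have hpos : 0 < p k := lt_of_lt_of_le (by positivity) ((hK t k).1 hk)
    rw [hK, not_le] at hks
    have h2 := Real.log_le_log hpos hks.le
    rwa [one_div, Real.log_inv, Real.log_exp] at h2
  have hKm : ∀ s t, s ≤ t → K s ⊆ K t := by
    intro s t hst k hk
    rw [hK] at *
    exact le_trans (by gcongr) hk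
  have hcard : ∀ s, rhoJ p 1 (Real.exp s) = (K s).card := fun s => rho_one p hp0 hp1 hlt s (K s) (hK s)
  have mono := rho_mono p hp0 hp1 hlt j
  have hsum := rho_succ p hp0 hp1 hlt j s (K s) (hK s)
  have hcell : ∀ i : ℕ, s * ((i : ℝ) / n) ≤ s * (((i : ℝ) + 1) / n) := by
    intro i
    gcongr
    linarith
  have hdiff : ∀ i : ℕ, rhoJ p 1 (Real.exp (s * (((i : ℝ) + 1) / n))) - rhoJ p 1 (Real.exp (s * ((i : ℝ) / n)))
      = ((K (s * (((i : ℝ) + 1) / n)) \ K (s * ((i : ℝ) / n))).card : ℝ) := by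
    intro i
    rw [hcard, hcard, Finset.card_sdiff_of_subset (hKm _ _ (hcell i)),
      Nat.cast_sub (Finset.card_le_card (hKm _ _ (hcell i)))]
  have hK0 : K 0 = ∅ := by
    ext k
    simp only [hK]
    simpa using hlt k
  have htel : ∀ m : ℕ, ∑ k ∈ K (s * ((m : ℝ) / n)), rhoJ p j (Real.exp (s + Real.log (p k))) =
      ∑ i ∈ Finset.range m, ∑ k ∈ K (s * (((i : ℝ) + 1) / n)) \ K (s * ((i : ℝ) / n)),
        rhoJ p j (Real.exp (s + Real.log (p k))) := by
    intro m
    induction m with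
    | zero => simp [hK0]
    | succ m ih =>
      rw [Finset.sum_range_succ, ← ih]
      push_cast
      rw [← Finset.sum_sdiff (hKm _ _ (hcell m))]
      exact add_comm _ _
  have h := htel n
  rw [div_self n0.ne', mul_one, ← hsum] at h
  rw [h]
  constructor
  · refine Finset.sum_le_sum (fun i _ => ?_)
    rw [hdiff, mul_comm (rhoJ p j _), ← nsmul_eq_mul]
    refine Finset.sum_le_card_nsmul _ _ _ (fun k hk => ?_)
    rw [Finset.mem_sdiff] at hk
    refine mono ?_
    have := hKlog' _ _ k hk.1 hk.2
    linarith
  · refine Finset.sum_le_sum (fun i _ => ?_)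
    rw [hdiff, mul_comm (rhoJ p j _), ← nsmul_eq_mul]
    refine Finset.card_nsmul_le_sum _ _ _ (fun k hk => ?_)
    rw [Finset.mem_sdiff] at hk
    refine mono ?_
    have := hKlog _ k hk.1
    linarith

theorem upgrade (f V : ℝ → ℝ) (α c : ℝ) (hα : 0 < α) (j : ℕ) (hj : 1 ≤ j) (hV : ∀ s > 0, 0 < V s)
    (hVr : ∀ x > 0, Tendsto (fun s => V (s * x) / V s) atTop (𝓝 (x ^ α))) (hf0 : f 0 = 0)
    (hf : Tendsto (fun s => f s / V s ^ j) atTop (𝓝 c)) (x : ℝ) (hx : 0 ≤ x) :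
    Tendsto (fun s => f (s * x) / V s ^ j) atTop (𝓝 (c * x ^ ((j : ℝ) * α))) := by
  have hj0 : (0 : ℝ) < j := by exact_mod_cast hj
  rcases hx.eq_or_lt with rfl | hx
  · rw [Real.zero_rpow (by positivity)]
    simp [hf0]
  · have h1 := (hf.comp (tendsto_id.atTop_mul_const hx)).mul ((hVr x hx).pow j)
    rw [← Real.rpow_natCast, ← Real.rpow_mul hx.le, mul_comm α] at h1
    refine h1.congr' ?_
    filter_upwards [eventually_gt_atTop 0] with s hs
    have v1 := hV s hs
    have v2 := hV (s * x) (by positivity)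
    simp only [Function.comp, id, div_pow]
    field_simp

theorem stmt1
    (p : ℕ → ℝ) (hp0 : ∀ k, 0 ≤ p k) (hp1 : ∑' k, p k = 1)
    (hpinf : {k | 0 < p k}.Infinite)
    (β : ℝ) (hβ : 0 ≤ β)
    (ℓ : ℝ → ℝ) (hℓpos : ∀ x > 0, 0 < ℓ x)
    (hℓsv : ∀ c > 0, Tendsto (fun x => ℓ (c * x) / ℓ x) atTop (𝓝 1))
    (h6 : ∀ lam > 0, Tendsto
      (fun t => (rhoJ p 1 (lam * t) - rhoJ p 1 t) / (Real.log t ^ β * ℓ (Real.log t)))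
      atTop (𝓝 (Real.log lam)))
    (h60 : β = 0 → (∃ x₀, MonotoneOn ℓ (Set.Ici x₀)) ∧ Tendsto ℓ atTop atTop)
    (j : ℕ) (hj : 1 ≤ j) :
    Tendsto
      (fun t => rhoJ p j t /
        (Real.log t ^ ((j : ℝ) * (β + 1)) * (ℓ (Real.log t)) ^ j))
      atTop
      (𝓝 ((Real.Gamma (β + 1)) ^ j / Real.Gamma (1 + j * (β + 1)))) := by
  have hlt := p_lt_one p hp0 hp1 hpinf
  set α := β + 1 with hα
  have hα1 : 1 ≤ α := by linarith
  have hα0 : 0 < α := by linarith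
  let V : ℝ → ℝ := fun s => s * (s ^ β * ℓ s)
  have hV : ∀ s > 0, 0 < V s := fun s hs =>
    mul_pos hs (mul_pos (Real.rpow_pos_of_pos hs _) (hℓpos s hs))
  have hVr : ∀ x > 0, Tendsto (fun s => V (s * x) / V s) atTop (𝓝 (x ^ α)) := by
    intro x hx
    have h1 := (hℓsv x hx).const_mul (x ^ α)
    rw [mul_one] at h1
    refine h1.congr' ?_
    filter_upwards [eventually_gt_atTop 0] with t ht
    have := hℓpos t ht
    have tb := Real.rpow_pos_of_pos ht β
    have xb := Real.rpow_pos_of_pos hx β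
    simp only [V]
    rw [hα, Real.rpow_add hx, Real.rpow_one, Real.mul_rpow ht.le hx.le, mul_comm t x]
    field_simp
  have h6' : ∀ h, Tendsto (fun s => (rhoJ p 1 (Real.exp (s + h)) - rhoJ p 1 (Real.exp s)) /
      (s ^ β * ℓ s)) atTop (𝓝 h) := by
    intro h
    have h1 := (h6 (Real.exp h) (Real.exp_pos h)).comp Real.tendsto_exp_atTop
    rw [Real.log_exp] at h1
    refine h1.congr (fun s => ?_)
    simp only [Function.comp, Real.log_exp]
    rw [Real.exp_add, mul_comm (Real.exp s)]
  have base : Tendsto (fun s => rhoJ p 1 (Real.exp s) / V s) atTop (𝓝 (1 / α)) :=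
    base_lim (fun s => rhoJ p 1 (Real.exp s)) ℓ β hβ (rho_mono p hp0 hp1 hlt 1) hℓpos
      (fun s => Nat.cast_nonneg _) (fun s => ⟨_, rfl⟩) hℓsv h6'
  have main : ∀ j : ℕ, 1 ≤ j → Tendsto (fun s => rhoJ p j (Real.exp s) / V s ^ j) atTop
      (𝓝 ((Real.Gamma α) ^ j / Real.Gamma (1 + j * α))) := by
    intro j hj
    induction j, hj using Nat.le_induction with
    | base =>
      have e : Real.Gamma α ^ 1 / Real.Gamma (1 + ((1 : ℕ) : ℝ) * α) = 1 / α := by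
        rw [Nat.cast_one, one_mul, add_comm, Real.Gamma_add_one hα0.ne', pow_one]
        have := Real.Gamma_pos_of_pos hα0
        field_simp
      rw [e]
      simpa only [pow_one] using base
    | succ j hj ih =>
      set c := (Real.Gamma α) ^ j / Real.Gamma (1 + j * α) with hc
      have hjα : 0 ≤ (j : ℝ) * α := by positivity
      have hc0 : 0 < c := div_pos (pow_pos (Real.Gamma_pos_of_pos hα0) _)
        (Real.Gamma_pos_of_pos (by linarith))
      have u1 := fun x hx => upgrade (fun s => rhoJ p 1 (Real.exp s)) V α (1 / α) hα0 1 le_rfl hV hVr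
        (rho_at_zero p hp0 hp1 hlt 1 le_rfl) (by simpa only [pow_one] using base) x hx
      have uj := fun x hx => upgrade (fun s => rhoJ p j (Real.exp s)) V α c hα0 j hj hV hVr
        (rho_at_zero p hp0 hp1 hlt j hj) ih x hx
      simp only [pow_one, Nat.cast_one, one_mul] at u1
      set I := α * (Real.Gamma (j * α + 1) * Real.Gamma α / Real.Gamma (j * α + 1 + α)) with hI
      have target : Real.Gamma α ^ (j + 1) / Real.Gamma (1 + ((j + 1 : ℕ) : ℝ) * α) = c / α * I := by
        have g1 : 0 < Real.Gamma (1 + j * α) := Real.Gamma_pos_of_pos (by linarith)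
        have g2 : 0 < Real.Gamma (1 + j * α + α) := Real.Gamma_pos_of_pos (by linarith)
        rw [hI, hc, add_comm ((j : ℝ) * α) 1]
        rw [show 1 + ((j + 1 : ℕ) : ℝ) * α = 1 + j * α + α by push_cast; ring]
        field_simp
        exact pow_succ _ _
      rw [target, Metric.tendsto_nhds]
      intro ε hε
      obtain ⟨n, hn⟩ := exists_nat_gt (2 * c / ε)
      have n0' : (0 : ℝ) < n := lt_of_le_of_lt (by positivity) hn
      have n0 : 0 < n := by exact_mod_cast n0'
      have hcn : c / α * (α / n) < ε / 2 := by
        rw [div_lt_iff₀ hε] at hn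
        have : c / α * (α / n) = c / n := by field_simp
        rw [this, div_lt_iff₀ n0']
        linarith
      obtain ⟨rb1, rb2⟩ := riemann_bounds (j * α) α hjα hα1 n n0
      rw [← hI] at rb1 rb2
      have cell : ∀ i ∈ Finset.range n, ∀ y : ℝ, 0 ≤ y → Tendsto (fun s =>
          rhoJ p j (Real.exp (s * y)) * (rhoJ p 1 (Real.exp (s * (((i : ℝ) + 1) / n))) -
            rhoJ p 1 (Real.exp (s * ((i : ℝ) / n)))) / V s ^ (j + 1)) atTop
          (𝓝 (c / α * (y ^ ((j : ℝ) * α) * ((((i : ℝ) + 1) / n) ^ α - ((i : ℝ) / n) ^ α)))) := by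
        intro i _ y hy
        have h1 := (uj y hy).mul ((u1 (((i : ℝ) + 1) / n) (by positivity)).sub
          (u1 ((i : ℝ) / n) (by positivity)))
        have e : c * y ^ ((j : ℝ) * α) * (1 / α * (((i : ℝ) + 1) / n) ^ α - 1 / α * ((i : ℝ) / n) ^ α) =
            c / α * (y ^ ((j : ℝ) * α) * ((((i : ℝ) + 1) / n) ^ α - ((i : ℝ) / n) ^ α)) := by ring
        rw [e] at h1
        refine h1.congr (fun s => ?_)
        rw [← sub_div, div_mul_div_comm, ← pow_succ]
      have le1 : ∀ i ∈ Finset.range n, 0 ≤ 1 - ((i : ℝ) + 1) / n := by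
        intro i hi
        rw [sub_nonneg, div_le_one n0']
        exact_mod_cast Finset.mem_range.1 hi
      have le2 : ∀ i ∈ Finset.range n, 0 ≤ 1 - (i : ℝ) / n := by
        intro i hi
        rw [sub_nonneg, div_le_one n0']
        exact_mod_cast (Finset.mem_range.1 hi).le
      have tL := tendsto_finsetSum (Finset.range n) (fun i hi => cell i hi _ (le1 i hi))
      have tU := tendsto_finsetSum (Finset.range n) (fun i hi => cell i hi _ (le2 i hi))
      rw [← Finset.mul_sum] at tL tU
      simp only [← Finset.sum_div] at tL tU
      have hca : 0 < c / α := by positivity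
      have bL : c / α * I - ε / 2 < c / α * ∑ i ∈ Finset.range n, (1 - ((i : ℝ) + 1) / n) ^ ((j : ℝ) * α) *
          ((((i : ℝ) + 1) / n) ^ α - ((i : ℝ) / n) ^ α) := by
        have := mul_le_mul_of_nonneg_left rb1 hca.le
        rw [mul_sub] at this
        linarith
      have bU : c / α * ∑ i ∈ Finset.range n, (1 - (i : ℝ) / n) ^ ((j : ℝ) * α) *
          ((((i : ℝ) + 1) / n) ^ α - ((i : ℝ) / n) ^ α) < c / α * I + ε / 2 := by
        have := mul_le_mul_of_nonneg_left rb2 hca.le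
        rw [mul_add (c / α) I] at this
        linarith
      filter_upwards [tL.eventually (lt_mem_nhds bL), tU.eventually (gt_mem_nhds bU),
        eventually_gt_atTop 0] with s h1 h2 hs
      have hVs := pow_pos (hV s hs) (j + 1)
      obtain ⟨cb1, cb2⟩ := conv_bounds p hp0 hp1 hlt j s hs.le n n0
      have d1 := div_le_div_of_nonneg_right cb1 hVs.le
      have d2 := div_le_div_of_nonneg_right cb2 hVs.le
      rw [Real.dist_eq, abs_lt]
      constructor <;> linarith
  refine ((main j hj).comp Real.tendsto_log_atTop).congr' ?_
  filter_upwards [eventually_gt_atTop 1] with t ht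
  have hlog := Real.log_pos ht
  simp only [Function.comp, V]
  rw [Real.exp_log (by linarith)]
  congr 1
  rw [← mul_assoc, mul_pow, mul_comm (j : ℝ), Real.rpow_mul hlog.le, Real.rpow_natCast, hα,
    Real.rpow_add hlog, Real.rpow_one, mul_comm (Real.log t)]
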